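/- Let g ≥ 1 and n = 2g+2. Let A, B be real symmetric n×n matrices whose invariant binary form f(x,y) = (−1)^{n(n−1)/2}·det(A·x − B·y) is squarefree of degree n over ℂ (nonzero discriminant), and let 2m be the number of zeros of f in P¹(ℝ), i.e. 2m equals the number of distinct real roots of the polynomial f(T,1), plus 1 if the coefficient of xⁿ in f is zero. Then the stabilizer {h : h is a real n×n matrix, det h = 1, hᵗAh = A, hᵗBh = B} is a finite group, of cardinality 2^{g+m} if m ≥ 1 and of cardinality 2^{g+1} if m = 0. -/

import Mathlib

open MvPolynomial Matrix

/-- The invariant binary form of a pair of `n × n` matrices `(A, B)` over a commutative ring: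
`f_{A,B}(x,y) = (-1)^(n(n-1)/2) · det(A·x - B·y)`. -/
noncomputable def invBinForm {R : Type*} [CommRing R] (n : ℕ)
    (A B : Matrix (Fin n) (Fin n) R) : MvPolynomial (Fin 2) R :=
  (-1) ^ (n * (n - 1) / 2) *
    (Matrix.of fun i j => C (A i j) * X 0 - C (B i j) * X 1).det

/-- The sign vectors invariant under `σ` are determined by their values on a half of the index set
containing a representative of each orbit. -/
noncomputable def invariantSignsEquiv {ι : Type*} (σ : ι → ι) (hσ : ∀ i, σ (σ i) = i) (s : ι → ℝ)
    (hs : ∀ i, s (σ i) = -s i) (h0 : ∀ i, s i = 0 → σ i = i) :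
    {e : ι → ℤˣ // ∀ i, e (σ i) = e i} ≃ ({i // 0 ≤ s i} → ℤˣ) where
  toFun e i := e.1 i
  invFun e := ⟨fun i => if h : 0 ≤ s i then e ⟨i, h⟩ else
      e ⟨σ i, by rw [hs]; linarith⟩, by
    intro i
    rcases lt_trichotomy (s i) 0 with h | h | h
    · have h1 : ¬ 0 ≤ s i := by linarith
      have h2 : 0 ≤ s (σ i) := by rw [hs]; linarith
      simp [h1, h2]
    · rw [h0 i h]
    · have h1 : 0 ≤ s i := by linarith
      have h2 : ¬ 0 ≤ s (σ i) := by rw [hs]; linarith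
      simp [h1, h2, hσ]⟩
  left_inv e := by
    ext i
    by_cases h : 0 ≤ s i
    · simp [h]
    · simp [h, e.2 i]
  right_inv e := by
    ext i
    simp [i.2]

lemma card_nonneg_of_involution {ι : Type*} [Fintype ι] (σ : ι → ι) (hσ : ∀ i, σ (σ i) = i)
    (s : ι → ℝ) (hs : ∀ i, s (σ i) = -s i) {g m : ℕ} (hcard : Fintype.card ι = 2 * g + 2)
    (hm : (Finset.univ.filter fun i => s i = 0).card = 2 * m) :
    Nat.card {i // 0 ≤ s i} = g + m + 1 := by
  classical
  have hneg : (Finset.univ.filter fun i => s i < 0).card =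
      (Finset.univ.filter fun i => 0 < s i).card :=
    Finset.card_bij (fun i _ => σ i) (by simp [hs])
      (fun a _ b _ h => by rw [← hσ a, h, hσ])
      (fun b hb => ⟨σ b, by simpa [hs] using hb, hσ b⟩)
  have hnn : (Finset.univ.filter fun i => 0 ≤ s i).card =
      (Finset.univ.filter fun i => s i = 0).card + (Finset.univ.filter fun i => 0 < s i).card := by
    rw [← Finset.card_union_of_disjoint]
    · congr 1
      ext i
      simp [le_iff_eq_or_lt, eq_comm]
    · rw [Finset.disjoint_filter]
      intro i _ h
      simp [h]
  have htot := Finset.card_filter_add_card_filter_not (s := (Finset.univ : Finset ι))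
    (fun i => 0 ≤ s i)
  simp only [not_le, Finset.card_univ] at htot
  rw [Nat.card_eq_fintype_card, Fintype.card_subtype]
  omega

lemma ncard_invariant_signs {ι : Type*} [Fintype ι] (σ : ι → ι) (hσ : ∀ i, σ (σ i) = i)
    (s : ι → ℝ) (hs : ∀ i, s (σ i) = -s i) (h0 : ∀ i, s i = 0 → σ i = i) {g m : ℕ}
    (hcard : Fintype.card ι = 2 * g + 2)
    (hm : (Finset.univ.filter fun i => s i = 0).card = 2 * m) :
    {e : ι → ℤˣ | ∀ i, e (σ i) = e i}.ncard = 2 ^ (g + m + 1) := by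
  classical
  rw [← Nat.card_coe_set_eq]
  refine (Nat.card_congr (invariantSignsEquiv σ hσ s hs h0)).trans ?_
  rw [Nat.card_fun, card_nonneg_of_involution σ hσ s hs hcard hm]
  simp

/-- The number of sign vectors of product `1` invariant under an involution. -/
lemma ncard_invariant_signs_prod_one {ι : Type*} [Fintype ι] (σ : ι → ι) (hσ : ∀ i, σ (σ i) = i)
    (s : ι → ℝ) (hs : ∀ i, s (σ i) = -s i) (h0 : ∀ i, s i = 0 → σ i = i) {g m : ℕ}
    (hcard : Fintype.card ι = 2 * g + 2)
    (hm : (Finset.univ.filter fun i => s i = 0).card = 2 * m) :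
    {e : ι → ℤˣ | (∀ i, e (σ i) = e i) ∧ ∏ i, e i = 1}.ncard =
      if 1 ≤ m then 2 ^ (g + m) else 2 ^ (g + 1) := by
  classical
  have hU := ncard_invariant_signs σ hσ s hs h0 hcard hm
  split_ifs with h
  · obtain ⟨k, hk⟩ : (Finset.univ.filter fun i => s i = 0).Nonempty := by
      rw [← Finset.card_pos]; omega
    have hk0 : σ k = k := h0 k (by simpa using hk)
    set flip : ι → ℤˣ := Function.update 1 k (-1) with hflip
    have hfprod : ∏ i, flip i = -1 := by
      rw [hflip, Finset.prod_update_of_mem (Finset.mem_univ k)]; simp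
    have hfinv : ∀ i, flip (σ i) = flip i := by
      intro i
      by_cases hi : i = k
      · rw [hi, hk0]
      · have : σ i ≠ k := fun h' => hi (by rw [← hσ i, h', hk0])
        simp [hflip, hi, this]
    have hunion : {e : ι → ℤˣ | ∀ i, e (σ i) = e i} =
        {e : ι → ℤˣ | (∀ i, e (σ i) = e i) ∧ ∏ i, e i = 1} ∪
        (fun e => flip * e) '' {e : ι → ℤˣ | (∀ i, e (σ i) = e i) ∧ ∏ i, e i = 1} := by
      ext e
      constructor
      · intro he
        rcases Int.units_eq_one_or (∏ i, e i) with h1 | h1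
        · exact Or.inl ⟨he, h1⟩
        · refine Or.inr ⟨flip * e, ⟨fun i => ?_, ?_⟩, ?_⟩
          · simp [hfinv, he i]
          · simp [Finset.prod_mul_distrib, hfprod, h1]
          · ext i
            simp [← mul_assoc]
      · rintro (he | ⟨e', he, rfl⟩)
        · exact he.1
        · intro i
          simp [hfinv, he.1 i]
    rw [hunion, Set.ncard_union_eq, Set.ncard_image_of_injective _ (mul_right_injective flip)] at hU
    · rw [pow_succ] at hU
      omega
    · rw [Set.disjoint_left]
      rintro _ he ⟨e', he', rfl⟩
      have := he.2
      simp [Finset.prod_mul_distrib, hfprod, he'.2] at this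
  · have hm0 : m = 0 := by omega
    subst hm0
    have hempty : ∀ i, s i ≠ 0 := by
      intro i hi
      rw [mul_zero, Finset.card_eq_zero] at hm
      have : i ∈ (Finset.univ.filter fun i => s i = 0) := by simpa using hi
      simp [hm] at this
    rw [add_zero] at hU
    rw [← hU]
    congr 1
    ext e
    refine ⟨fun h => h.1, fun h => ⟨h, ?_⟩⟩
    refine Finset.prod_involution (fun i _ => σ i) ?_ ?_ (by simp) (by simp [hσ])
    · intro i _
      rw [h i]
      exact Int.units_mul_self _
    · intro i _ _ hi
      have := hs i
      rw [hi] at this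
      exact hempty i (by linarith)

lemma exists_diagonalization {ι K : Type*} [Fintype ι] [DecidableEq ι] [Field K]
    (M : Matrix ι ι K) (lam : ι → K) (hinj : Function.Injective lam)
    (hroot : ∀ i, M.charpoly.IsRoot (lam i)) :
    ∃ P Q : Matrix ι ι K, P * Q = 1 ∧ Q * P = 1 ∧ M * P = P * diagonal lam := by
  have hv : ∀ i, ∃ v : ι → K, v ≠ 0 ∧ M *ᵥ v = lam i • v := by
    intro i
    have h := hroot i
    rw [Polynomial.IsRoot, Matrix.eval_charpoly, ← exists_mulVec_eq_zero_iff] at h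
    obtain ⟨v, hv, h⟩ := h
    refine ⟨v, hv, ?_⟩
    rw [sub_mulVec, sub_eq_zero] at h
    rw [← h]
    simp [Matrix.scalar_apply, ← Matrix.smul_one_eq_diagonal, smul_mulVec]
  choose v hv0 hv using hv
  have hlin : LinearIndependent K v :=
    Module.End.eigenvectors_linearIndependent' (toLin' M) lam hinj v fun i =>
      Module.End.hasEigenvector_iff.mpr ⟨Module.End.mem_eigenspace_iff.mpr (by simp [hv]), hv0 i⟩
  have hunit : IsUnit (Matrix.of v) := linearIndependent_rows_iff_isUnit.mp hlin
  have hdet : IsUnit (Matrix.of v)ᵀ.det := by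
    rw [det_transpose]; exact (isUnit_iff_isUnit_det _).mp hunit
  refine ⟨(Matrix.of v)ᵀ, (Matrix.of v)ᵀ⁻¹, mul_nonsing_inv _ hdet, nonsing_inv_mul _ hdet, ?_⟩
  ext i j
  have := congrFun (hv j) i
  simp only [mulVec, dotProduct, Pi.smul_apply, smul_eq_mul] at this
  rw [mul_diagonal]
  simp [Matrix.mul_apply, this, mul_comm]

/-- A matrix commuting with a diagonal matrix with distinct entries is diagonal. -/
lemma eq_diagonal_of_commute {ι K : Type*} [Fintype ι] [DecidableEq ι] [Field K]
    {E : Matrix ι ι K} {lam : ι → K} (hinj : Function.Injective lam)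
    (hcomm : E * diagonal lam = diagonal lam * E) : E = diagonal fun i => E i i := by
  ext i j
  by_cases h : i = j
  · subst h; simp
  · have := congrFun (congrFun hcomm i) j
    rw [mul_diagonal, diagonal_mul, mul_comm, ← sub_eq_zero, ← sub_mul, mul_eq_zero] at this
    rcases this with h' | h'
    · exact absurd (hinj (sub_eq_zero.mp h')).symm h
    · simp [h, h']

/-- If `M` is self-adjoint for the symmetric form `G` and has distinct eigenvalues, so is every
matrix commuting with `M`. -/
lemma transpose_mul_eq_of_commute {ι K : Type*} [Fintype ι] [DecidableEq ι] [Field K]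
    {M G h : Matrix ι ι K} {lam : ι → K} (hinj : Function.Injective lam)
    (hroot : ∀ i, M.charpoly.IsRoot (lam i)) (hM : Mᵀ * G = G * M) (hcomm : h * M = M * h) :
    hᵀ * G = G * h := by
  obtain ⟨P, Q, hPQ, hQP, hMP⟩ := exists_diagonalization M lam hinj hroot
  have hPQt : Qᵀ * Pᵀ = 1 := by rw [← transpose_mul, hPQ, transpose_one]
  have hQM : Q * M = diagonal lam * Q := by
    calc Q * M = Q * (M * P) * Q := by rw [mul_assoc, mul_assoc, hPQ, mul_one]
      _ = diagonal lam * Q := by rw [hMP, ← mul_assoc, hQP, one_mul]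
  have hMPt : Pᵀ * Mᵀ = diagonal lam * Pᵀ := by
    rw [← transpose_mul, hMP, transpose_mul, diagonal_transpose]
  have hE := eq_diagonal_of_commute (E := Q * h * P) hinj (by
    calc Q * h * P * diagonal lam = Q * (h * M) * P := by simp only [mul_assoc, hMP]
      _ = diagonal lam * (Q * h * P) := by rw [hcomm]; simp only [← mul_assoc, hQM])
  have hG := eq_diagonal_of_commute (E := Pᵀ * G * P) hinj (by
    calc Pᵀ * G * P * diagonal lam = Pᵀ * (G * M) * P := by simp only [mul_assoc, hMP]
      _ = diagonal lam * (Pᵀ * G * P) := by rw [← hM]; simp only [← mul_assoc, hMPt])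
  have hEt : (Q * h * P)ᵀ = Q * h * P := by rw [hE, diagonal_transpose]
  have hEG : Q * h * P * (Pᵀ * G * P) = Pᵀ * G * P * (Q * h * P) := by
    rw [hE, hG, diagonal_mul_diagonal, diagonal_mul_diagonal]
    simp only [mul_comm]
  calc hᵀ * G = Qᵀ * Pᵀ * hᵀ * (Qᵀ * Pᵀ) * G * (P * Q) := by
        rw [hPQt, hPQ, one_mul, mul_one, mul_one]
    _ = Qᵀ * ((Q * h * P)ᵀ * (Pᵀ * G * P)) * Q := by
        simp only [transpose_mul, mul_assoc]
    _ = Qᵀ * Pᵀ * G * (P * Q) * h * (P * Q) := by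
        rw [hEt, hEG]
        simp only [mul_assoc]
    _ = G * h := by rw [hPQt, hPQ, one_mul, mul_one, mul_one]

section Involutions

variable {ι : Type*} [Fintype ι] [DecidableEq ι]

/-- The complex diagonal matrix with diagonal entries given by a sign vector. -/
noncomputable def signDiagonal (e : ι → ℤˣ) : Matrix ι ι ℂ := diagonal fun i => ((e i : ℤ) : ℂ)

omit [Fintype ι] in
lemma signDiagonal_injective : Function.Injective (signDiagonal (ι := ι)) := by
  intro e e' h
  ext i
  have := congrFun (diagonal_injective h) i
  exact_mod_cast this

lemma signDiagonal_mul_self (e : ι → ℤˣ) : signDiagonal e * signDiagonal e = 1 := by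
  rw [signDiagonal, diagonal_mul_diagonal, ← diagonal_one]
  congr 1
  ext i
  rcases Int.units_eq_one_or (e i) with h | h <;> simp [h]

lemma det_signDiagonal (e : ι → ℤˣ) : (signDiagonal e).det = (((∏ i, e i : ℤˣ) : ℤ) : ℂ) := by
  simp [signDiagonal]

lemma conj_signDiagonal (e : ι → ℤˣ) :
    (starRingEnd ℂ).mapMatrix (signDiagonal e) = signDiagonal e := by
  ext i j
  by_cases h : i = j
  · subst h; simp [signDiagonal]
  · simp [signDiagonal, h]

lemma exists_eq_signDiagonal {E : Matrix ι ι ℂ} {lam : ι → ℂ} (hinj : Function.Injective lam)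
    (hcomm : E * diagonal lam = diagonal lam * E) (hE : E * E = 1) :
    ∃ e : ι → ℤˣ, E = signDiagonal e := by
  have hED := eq_diagonal_of_commute hinj hcomm
  have hsq : ∀ i, E i i = 1 ∨ E i i = -1 := by
    intro i
    rw [hED, diagonal_mul_diagonal, ← diagonal_one] at hE
    exact mul_self_eq_one_iff.mp (congrFun (diagonal_injective hE) i)
  have : ∀ i, ∃ u : ℤˣ, E i i = ((u : ℤ) : ℂ) := by
    intro i
    rcases hsq i with h | h
    · exact ⟨1, by simp [h]⟩
    · exact ⟨-1, by simp [h]⟩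
  choose e he using this
  refine ⟨e, hED.trans ?_⟩
  simp only [signDiagonal, he]

lemma signDiagonal_commute_iff {N N' : Matrix ι ι ℂ} (hN : N * N' = 1) {σ : ι → ι}
    (hsupp : ∀ i j, N i j ≠ 0 → i = σ j) (e : ι → ℤˣ) :
    signDiagonal e * N = N * signDiagonal e ↔ ∀ i, e (σ i) = e i := by
  have hN' : N' * N = 1 := mul_eq_one_comm.mp hN
  constructor
  · intro h j
    have : ∃ i, N i j ≠ 0 := by
      by_contra! h0
      have := congrFun (congrFun hN' j) j
      simp [Matrix.mul_apply, h0] at this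
    obtain ⟨i, hi⟩ := this
    have h2 := congrFun (congrFun h i) j
    rw [signDiagonal, diagonal_mul, mul_diagonal, mul_comm] at h2
    have h3 := mul_left_cancel₀ hi h2
    rw [← hsupp i j hi]
    ext
    exact_mod_cast h3
  · intro h
    ext i j
    rw [signDiagonal, diagonal_mul, mul_diagonal]
    by_cases h0 : N i j = 0
    · simp [h0]
    · rw [hsupp i j h0, h j, mul_comm]

/-- For a real matrix with distinct complex eigenvalues, the involutions of determinant `1` in its
centralizer correspond to the conjugation-invariant sign vectors of product `1`. -/
lemma involutions_centralizer (M : Matrix ι ι ℝ) (lam : ι → ℂ) (hinj : Function.Injective lam)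
    (hroot : ∀ i, (Complex.ofRealHom.mapMatrix M).charpoly.IsRoot (lam i)) (σ : ι → ι)
    (hσ : ∀ i, lam (σ i) = starRingEnd ℂ (lam i)) :
    {h : Matrix ι ι ℝ | h.det = 1 ∧ h * h = 1 ∧ h * M = M * h}.Finite ∧
    {h : Matrix ι ι ℝ | h.det = 1 ∧ h * h = 1 ∧ h * M = M * h}.ncard =
      {e : ι → ℤˣ | (∀ i, e (σ i) = e i) ∧ ∏ i, e i = 1}.ncard := by
  set c : Matrix ι ι ℝ →+* Matrix ι ι ℂ := Complex.ofRealHom.mapMatrix with hc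
  set k : Matrix ι ι ℂ →+* Matrix ι ι ℂ := (starRingEnd ℂ).mapMatrix with hk
  have hkc : ∀ X, k (c X) = c X := fun X => by ext i j; simp [hk, hc]
  have hcinj : Function.Injective c := fun X Y h => by
    ext i j
    simpa [hc] using congrFun (congrFun h i) j
  have hdetc : ∀ X, (c X).det = (X.det : ℂ) := fun X => (Complex.ofRealHom.map_det X).symm
  obtain ⟨P, Q, hPQ, hQP, hMP⟩ := exists_diagonalization (c M) lam hinj hroot
  have hQM : Q * c M = diagonal lam * Q := by
    calc Q * c M = Q * (c M * P) * Q := by rw [mul_assoc, mul_assoc, hPQ, mul_one]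
      _ = diagonal lam * Q := by rw [hMP, ← mul_assoc, hQP, one_mul]
  have hkPQ : k P * k Q = 1 := by rw [← map_mul, hPQ, map_one]
  have hkQP : k Q * k P = 1 := by rw [← map_mul, hQP, map_one]
  have hNN : Q * k P * (k Q * P) = 1 := by
    rw [mul_assoc, ← mul_assoc (k P), hkPQ, one_mul, hQP]
  have hDN : diagonal lam * (Q * k P) = Q * k P * k (diagonal lam) := by
    rw [← mul_assoc, ← hQM, mul_assoc, mul_assoc, ← map_mul k P, ← hMP, map_mul, hkc]
  have hsupp : ∀ i j, (Q * k P) i j ≠ 0 → i = σ j := by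
    intro i j h
    have hkD : k (diagonal lam) = diagonal fun i => starRingEnd ℂ (lam i) := by
      simp only [hk, RingHom.mapMatrix_apply]
      rw [diagonal_map (map_zero _)]
    have := congrFun (congrFun hDN i) j
    rw [hkD, diagonal_mul, mul_diagonal, mul_comm] at this
    exact hinj ((mul_left_cancel₀ h this).trans (hσ j).symm)
  have hreal : ∀ e : ι → ℤˣ, (∀ i, e (σ i) = e i) ↔
      k (P * signDiagonal e * Q) = P * signDiagonal e * Q := by
    intro e
    rw [← signDiagonal_commute_iff hNN hsupp, map_mul, map_mul, hk, conj_signDiagonal, ← hk]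
    constructor
    · intro h
      calc k P * signDiagonal e * k Q = P * (Q * k P * signDiagonal e) * k Q := by
            rw [← mul_assoc, ← mul_assoc, hPQ, one_mul]
        _ = P * signDiagonal e * Q := by
            rw [← h]
            simp only [mul_assoc, hkPQ, mul_one]
    · intro h
      calc signDiagonal e * (Q * k P) = Q * (P * signDiagonal e * Q) * k P := by
            simp only [← mul_assoc, hQP, one_mul]
        _ = Q * k P * signDiagonal e := by
            rw [← h]
            simp only [mul_assoc, hkQP, mul_one]
  set F : (ι → ℤˣ) → Matrix ι ι ℝ := fun e => (P * signDiagonal e * Q).map Complex.re with hF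
  have hcF : ∀ e : ι → ℤˣ, (∀ i, e (σ i) = e i) → c (F e) = P * signDiagonal e * Q := by
    intro e he
    ext i j
    have := congrFun (congrFun ((hreal e).mp he) i) j
    simp only [hk, RingHom.mapMatrix_apply, map_apply] at this
    simpa [hc, hF] using Complex.conj_eq_iff_re.mp this
  have hdetPQ : ∀ E : Matrix ι ι ℂ, (P * E * Q).det = E.det := fun E => by
    rw [det_mul_right_comm, hPQ, one_mul]
  have himage : {h : Matrix ι ι ℝ | h.det = 1 ∧ h * h = 1 ∧ h * M = M * h} =
      F '' {e : ι → ℤˣ | (∀ i, e (σ i) = e i) ∧ ∏ i, e i = 1} := by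
    ext h
    constructor
    · rintro ⟨hdet, hsq, hcomm⟩
      obtain ⟨e, he⟩ := exists_eq_signDiagonal (E := Q * c h * P) hinj
        (by
          calc Q * c h * P * diagonal lam = Q * (c h * c M) * P := by
                simp only [mul_assoc, hMP]
            _ = diagonal lam * (Q * c h * P) := by
                rw [← map_mul, hcomm, map_mul]
                simp only [← mul_assoc, hQM])
        (by
          calc Q * c h * P * (Q * c h * P) = Q * (c h * (P * Q) * c h) * P := by
                simp only [mul_assoc]
            _ = 1 := by rw [hPQ, mul_one, ← map_mul, hsq, map_one, mul_one, hQP])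
      have hch : c h = P * signDiagonal e * Q := by
        rw [← he]
        simp only [mul_assoc, hPQ, mul_one]
        rw [← mul_assoc, hPQ, one_mul]
      have hinv : ∀ i, e (σ i) = e i := (hreal e).mpr (by rw [← hch, hkc])
      refine ⟨e, ⟨hinv, ?_⟩, hcinj ((hcF e hinv).trans hch.symm)⟩
      have := hdetc h
      rw [hch, hdetPQ, det_signDiagonal, hdet] at this
      refine Units.ext (Int.cast_injective (α := ℂ) ?_)
      rw [this]
      simp
    · rintro ⟨e, ⟨hinv, hprod⟩, rfl⟩
      have hch := hcF e hinv
      refine ⟨?_, hcinj ?_, hcinj ?_⟩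
      · have := hdetc (F e)
        rw [hch, hdetPQ, det_signDiagonal, hprod] at this
        exact_mod_cast this.symm
      · rw [map_mul, hch, map_one]
        calc P * signDiagonal e * Q * (P * signDiagonal e * Q)
            = P * (signDiagonal e * (Q * P) * signDiagonal e) * Q := by simp only [mul_assoc]
          _ = 1 := by rw [hQP, mul_one, signDiagonal_mul_self, mul_one, hPQ]
      · rw [map_mul, map_mul, hch, mul_assoc, hQM]
        calc P * signDiagonal e * (diagonal lam * Q)
            = P * (signDiagonal e * diagonal lam) * Q := by simp only [mul_assoc]
          _ = P * (diagonal lam * signDiagonal e) * Q := by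
              simp only [signDiagonal, diagonal_mul_diagonal, mul_comm]
          _ = c M * (P * signDiagonal e * Q) := by
              simp only [← mul_assoc, hMP]
  have hFinj : Set.InjOn F {e : ι → ℤˣ | (∀ i, e (σ i) = e i) ∧ ∏ i, e i = 1} := by
    intro e he e' he' h
    apply signDiagonal_injective
    have h2 : P * signDiagonal e * Q = P * signDiagonal e' * Q := by
      rw [← hcF e he.1, ← hcF e' he'.1, h]
    calc signDiagonal e = Q * (P * signDiagonal e * Q) * P := by
          simp only [mul_assoc, hQP, mul_one]
          rw [← mul_assoc, hQP, one_mul]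
      _ = signDiagonal e' := by
          rw [h2]
          simp only [mul_assoc, hQP, mul_one]
          rw [← mul_assoc, hQP, one_mul]
  rw [himage]
  exact ⟨(Set.toFinite _).image F, hFinj.ncard_image⟩

end Involutions

section Pencil

variable {n : ℕ}

lemma eval_invBinForm {R : Type*} [CommRing R] (A B : Matrix (Fin n) (Fin n) R) (x : Fin 2 → R) :
    eval x (invBinForm n A B) = (-1) ^ (n * (n - 1) / 2) * (x 0 • A - x 1 • B).det := by
  rw [invBinForm, map_mul, map_pow, map_neg, map_one, RingHom.map_det]
  congr 2
  ext i j
  simp [mul_comm]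

lemma eval_aeval_invBinForm {R : Type*} [CommRing R] (A B : Matrix (Fin n) (Fin n) R) (t : R) :
    (MvPolynomial.aeval ![Polynomial.X, 1] (invBinForm n A B) : Polynomial R).eval t =
      (-1) ^ (n * (n - 1) / 2) * (t • A - B).det := by
  have h : (Polynomial.aeval t).comp (MvPolynomial.aeval ![(Polynomial.X : Polynomial R), 1]) =
      MvPolynomial.aeval ![t, 1] := by
    ext i
    fin_cases i <;> simp
  have h2 := DFunLike.congr_fun h (invBinForm n A B)
  rw [AlgHom.comp_apply, Polynomial.coe_aeval_eq_eval, MvPolynomial.aeval_eq_eval] at h2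
  rw [h2]
  simpa using eval_invBinForm A B ![t, 1]

lemma coeff_single_zero {R : Type*} [CommRing R] (p : MvPolynomial (Fin 2) R) (k : ℕ) :
    coeff (Finsupp.single 0 k) p =
      (MvPolynomial.aeval ![(Polynomial.X : Polynomial R), 0] p).coeff k := by
  induction p using MvPolynomial.induction_on' with
  | monomial d a =>
    rw [coeff_monomial, aeval_monomial, Finsupp.prod_fintype _ _ (by simp), Fin.prod_univ_two]
    by_cases h1 : d 1 = 0
    · by_cases h0 : d 0 = k
      · have : d = Finsupp.single 0 k := by ext i; fin_cases i <;> simp [h0, h1]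
        simp [this]
      · have : d ≠ Finsupp.single 0 k := by rintro rfl; simp at h0
        simp [this, h1, Polynomial.coeff_X_pow, Ne.symm h0]
    · have : d ≠ Finsupp.single 0 k := by rintro rfl; simp at h1
      simp [this, h1]
  | add p q hp hq => simp [hp, hq]

lemma coeff_invBinForm {R : Type*} [CommRing R] (A B : Matrix (Fin n) (Fin n) R) :
    coeff (Finsupp.single 0 n) (invBinForm n A B) = (-1) ^ (n * (n - 1) / 2) * A.det := by
  have h : (MvPolynomial.aeval ![(Polynomial.X : Polynomial R), 0] (invBinForm n A B)) =
      Polynomial.C ((-1) ^ (n * (n - 1) / 2) * A.det) * Polynomial.X ^ n := by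
    have hmap : (MvPolynomial.aeval ![(Polynomial.X : Polynomial R), 0]).mapMatrix
        (Matrix.of fun i j => C (A i j) * X 0 - C (B i j) * X 1) =
        (Polynomial.X : Polynomial R) • Polynomial.C.mapMatrix A := by
      ext1 i j
      simp only [AlgHom.mapMatrix_apply, RingHom.mapMatrix_apply, map_apply, of_apply, map_sub,
        map_mul, aeval_X, aeval_C, Polynomial.algebraMap_eq, Matrix.smul_apply, smul_eq_mul]
      simp only [cons_val_zero, cons_val_one, mul_zero, sub_zero]
      exact mul_comm _ _
    rw [invBinForm, map_mul, map_pow, map_neg, map_one, AlgHom.map_det, hmap, det_smul,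
      ← RingHom.map_det, Fintype.card_fin, map_mul, map_pow, map_neg, map_one]
    ring
  rw [coeff_single_zero, h, Polynomial.coeff_C_mul, Polynomial.coeff_X_pow_self, mul_one]

lemma map_invBinForm {R S : Type*} [CommRing R] [CommRing S] (φ : R →+* S)
    (A B : Matrix (Fin n) (Fin n) R) :
    invBinForm n (A.map φ) (B.map φ) = MvPolynomial.map φ (invBinForm n A B) := by
  rw [invBinForm, invBinForm, map_mul, map_pow, map_neg, map_one, RingHom.map_det]
  congr 2
  ext1 i j
  simp

lemma exists_det_ne_zero {K : Type*} [Field K] [Infinite K] {A B : Matrix (Fin n) (Fin n) K}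
    (h : invBinForm n A B ≠ 0) : ∃ a b : K, b ≠ 0 ∧ (a • A - b • B).det ≠ 0 := by
  by_contra! h0
  have : invBinForm n A B * X 1 = 0 := by
    refine MvPolynomial.funext fun x => ?_
    by_cases hx : x 1 = 0
    · simp [hx]
    · simp [eval_invBinForm, h0 (x 0) (x 1) hx]
  exact h (by simpa using this)

lemma det_mul_eval_charpoly {R : Type*} [CommRing R] {A B M : Matrix (Fin n) (Fin n) R} {a b : R}
    (hM : (a • A - b • B) * M = A) (x : R) :
    (a • A - b • B).det * M.charpoly.eval x = ((x * a - 1) • A - (x * b) • B).det := by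
  rw [Matrix.eval_charpoly, ← det_mul, mul_sub, hM]
  congr 1
  rw [Matrix.scalar_apply, ← Matrix.smul_one_eq_diagonal, mul_smul_comm, mul_one]
  ext i j
  simp
  ring

/-- Factorization of the binary form of a regular pencil into linear forms. -/
lemma invBinForm_eq_prod {K : Type*} [Field K] [IsAlgClosed K] {A B M : Matrix (Fin n) (Fin n) K}
    {a b : K} (hb : b ≠ 0) (hM : (a • A - b • B) * M = A) :
    invBinForm n A B = C ((-1) ^ (n * (n - 1) / 2) * (a • A - b • B).det) *
      (M.charpoly.roots.map fun r => C b⁻¹ * X 1 - (C (a / b) * X 1 - X 0) * C r).prod := by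
  have : Infinite K := IsAlgClosed.instInfinite
  have hW : (C (a / b) * X 1 - X 0 : MvPolynomial (Fin 2) K) ≠ 0 := by
    intro h
    simpa using congrArg (eval ![-1, 0]) h
  refine mul_left_cancel₀ hW (MvPolynomial.funext fun x => ?_)
  rw [map_mul, map_mul, map_mul, eval_C]
  set w : K := eval x (C (a / b) * X 1 - X 0) with hw
  by_cases hw0 : w = 0
  · simp [hw0]
  congr 1
  have hwx : w = a / b * x 1 - x 0 := by simp [hw]
  have hcard : Multiset.card M.charpoly.roots = n := by
    rw [← (IsAlgClosed.splits M.charpoly).natDegree_eq_card_roots, charpoly_natDegree_eq_dim,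
      Fintype.card_fin]
  have hpencil : x 0 • A - x 1 • B =
      w • ((x 1 / (b * w) * a - 1) • A - (x 1 / (b * w) * b) • B) := by
    rw [smul_sub, smul_smul, smul_smul]
    congr 2
    · field_simp
      rw [hwx]
      field_simp
      ring
    · field_simp
  have hroots : eval x (M.charpoly.roots.map fun r =>
      C b⁻¹ * X 1 - (C (a / b) * X 1 - X 0) * C r).prod =
      w ^ n * M.charpoly.eval (x 1 / (b * w)) := by
    rw [(IsAlgClosed.splits _).eval_eq_prod_roots_of_monic M.charpoly_monic, map_multiset_prod,
      Multiset.map_map]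
    have hwn : w ^ n = (M.charpoly.roots.map fun _ => w).prod := by
      rw [Multiset.map_const', Multiset.prod_replicate, hcard]
    rw [hwn, ← Multiset.prod_map_mul]
    congr 1
    refine Multiset.map_congr rfl fun r _ => ?_
    simp only [Function.comp_apply, map_sub, map_mul, eval_C, eval_X]
    rw [← hwx]
    field_simp
  rw [eval_invBinForm, hpencil, det_smul, ← det_mul_eval_charpoly hM, hroots, Fintype.card_fin]
  ring

lemma nodup_roots_charpoly_of_squarefree {K : Type*} [Field K] [IsAlgClosed K]
    {A B M : Matrix (Fin n) (Fin n) K} {a b : K} (hb : b ≠ 0) (hM : (a • A - b • B) * M = A)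
    (hsf : Squarefree (invBinForm n A B)) : M.charpoly.roots.Nodup := by
  rw [Multiset.nodup_iff_le]
  intro r hr
  have hdvd := Multiset.prod_dvd_prod_of_le (Multiset.map_le_map (f := fun r =>
    (C b⁻¹ * X 1 - (C (a / b) * X 1 - X 0) * C r : MvPolynomial (Fin 2) K)) hr)
  have hunit := hsf (C b⁻¹ * X 1 - (C (a / b) * X 1 - X 0) * C r) (by
    rw [invBinForm_eq_prod hb hM]
    exact Dvd.dvd.mul_left (by simpa using hdvd) _)
  simpa using hunit.map (eval (0 : Fin 2 → K))

/-- The number of zeros of the binary form on the projective line equals the number of eigenvalues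
of the associated endomorphism. -/
lemma card_roots_charpoly {K : Type*} [Field K] [DecidableEq K] {A B M : Matrix (Fin n) (Fin n) K}
    {a b : K} (hb : b ≠ 0) (hdet : (a • A - b • B).det ≠ 0) (hM : (a • A - b • B) * M = A) :
    M.charpoly.roots.toFinset.card =
      ((MvPolynomial.aeval ![Polynomial.X, 1] (invBinForm n A B) :
          Polynomial K).roots.toFinset.card)
        + (if MvPolynomial.coeff (Finsupp.single 0 n) (invBinForm n A B) = 0 then 1 else 0) := by
  have hsign : ((-1 : K) ^ (n * (n - 1) / 2)) ≠ 0 := by simp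
  have hinf : (((a / b) • A - B).det) ≠ 0 := by
    intro h
    apply hdet
    have : a • A - b • B = b • ((a / b) • A - B) := by
      rw [smul_sub, smul_smul, mul_div_cancel₀ _ hb]
    rw [this, det_smul, h, mul_zero]
  have hp0 : (MvPolynomial.aeval ![Polynomial.X, 1] (invBinForm n A B) : Polynomial K) ≠ 0 := by
    intro h
    have := eval_aeval_invBinForm A B (a / b)
    rw [h, Polynomial.eval_zero] at this
    exact mul_ne_zero hsign hinf this.symm
  have hmem : ∀ x, x ∈ M.charpoly.roots.toFinset ↔
      ((x * a - 1) • A - (x * b) • B).det = 0 := by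
    intro x
    rw [Multiset.mem_toFinset, Polynomial.mem_roots M.charpoly_monic.ne_zero, Polynomial.IsRoot,
      ← det_mul_eval_charpoly hM, mul_eq_zero, or_iff_right hdet]
  have hmem2 : ∀ t, t ∈ (MvPolynomial.aeval ![Polynomial.X, 1] (invBinForm n A B) :
      Polynomial K).roots.toFinset ↔ (t • A - B).det = 0 := by
    intro t
    rw [Multiset.mem_toFinset, Polynomial.mem_roots hp0, Polynomial.IsRoot,
      eval_aeval_invBinForm, mul_eq_zero, or_iff_right hsign]
  have hzero : (0 ∈ M.charpoly.roots.toFinset) ↔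
      MvPolynomial.coeff (Finsupp.single 0 n) (invBinForm n A B) = 0 := by
    rw [hmem, coeff_invBinForm, mul_eq_zero, or_iff_right hsign]
    simp [det_neg]
  have hbij : (M.charpoly.roots.toFinset.erase 0).card = ((MvPolynomial.aeval ![Polynomial.X, 1]
      (invBinForm n A B) : Polynomial K).roots.toFinset.card) := by
    refine Finset.card_bij' (fun x _ => (x * a - 1) / (x * b)) (fun t _ => (a - b * t)⁻¹) ?_ ?_ ?_ ?_
    · intro x hx
      obtain ⟨hx0, hx⟩ := Finset.mem_erase.mp hx
      rw [hmem] at hx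
      rw [hmem2]
      have : (x * a - 1) • A - (x * b) • B =
          (x * b) • (((x * a - 1) / (x * b)) • A - B) := by
        rw [smul_sub, smul_smul, mul_div_cancel₀ _ (mul_ne_zero hx0 hb)]
      rw [this, det_smul, mul_eq_zero] at hx
      exact hx.resolve_left (pow_ne_zero _ (mul_ne_zero hx0 hb))
    · intro t ht
      rw [hmem2] at ht
      have hne : a - b * t ≠ 0 := fun h => hinf (by
        rw [← ht, sub_eq_zero.mp h, mul_div_cancel_left₀ _ hb])
      refine Finset.mem_erase.mpr ⟨inv_ne_zero hne, ?_⟩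
      rw [hmem]
      have : ((a - b * t)⁻¹ * a - 1) • A - ((a - b * t)⁻¹ * b) • B =
          ((a - b * t)⁻¹ * b) • (t • A - B) := by
        rw [smul_sub, smul_smul]
        congr 2
        field_simp
        ring
      rw [this, det_smul, ht, mul_zero]
    · intro x hx
      have hx0 := (Finset.mem_erase.mp hx).1
      field_simp
      simp
    · intro t ht
      rw [hmem2] at ht
      have hne : a - b * t ≠ 0 := fun h => hinf (by
        rw [← ht, sub_eq_zero.mp h, mul_div_cancel_left₀ _ hb])
      field_simp
      ring
  rw [← hbij]
  split_ifs with h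
  · rw [Finset.card_erase_add_one (hzero.mpr h)]
  · rw [Finset.erase_eq_of_notMem (fun h' => h (hzero.mp h')), add_zero]

end Pencil

section Stabilizer

variable {n : ℕ}

/-- The stabilizer of a pencil in `SL_n` consists of the involutions of determinant `1` commuting
with the self-adjoint endomorphism `M` attached to the pencil. -/
lemma stabilizer_eq_involutions {K : Type*} [Field K] {A B M : Matrix (Fin n) (Fin n) K}
    {a b : K} (hb : b ≠ 0) (hdet : (a • A - b • B).det ≠ 0) (hM : (a • A - b • B) * M = A)
    (hadj : ∀ h : Matrix (Fin n) (Fin n) K, h * M = M * h →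
      hᵀ * (a • A - b • B) = (a • A - b • B) * h) :
    {h : Matrix (Fin n) (Fin n) K | h.det = 1 ∧ hᵀ * A * h = A ∧ hᵀ * B * h = B} =
      {h : Matrix (Fin n) (Fin n) K | h.det = 1 ∧ h * h = 1 ∧ h * M = M * h} := by
  set G := a • A - b • B with hG
  have hGunit : IsUnit G := (isUnit_iff_isUnit_det _).mpr (isUnit_iff_ne_zero.mpr hdet)
  ext h
  refine and_congr_right fun hh => ⟨fun ⟨h1, h2⟩ => ?_, fun ⟨h1, h2⟩ => ?_⟩
  · have hGh : hᵀ * G * h = G := by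
      rw [hG, mul_sub, sub_mul, Matrix.mul_smul, Matrix.mul_smul, Matrix.smul_mul,
        Matrix.smul_mul, h1, h2]
    have hu : IsUnit (hᵀ * G) := by
      refine IsUnit.mul ((isUnit_iff_isUnit_det _).mpr ?_) hGunit
      rw [det_transpose, hh]
      exact isUnit_one
    have hcomm : h * M = M * h := by
      apply hu.mul_left_cancel
      rw [← mul_assoc, hGh, hM, ← mul_assoc, mul_assoc hᵀ, hM, h1]
    refine ⟨?_, hcomm⟩
    apply hGunit.mul_left_cancel
    rw [← mul_assoc, ← hadj h hcomm, hGh, mul_one]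
  · have hGh : hᵀ * G * h = G := by rw [hadj h h2, mul_assoc, h1, mul_one]
    have hAh : hᵀ * A * h = A := by
      calc hᵀ * A * h = hᵀ * G * (M * h) := by rw [← hM]; simp only [mul_assoc]
        _ = A := by rw [← h2, ← mul_assoc, hGh, hM]
    refine ⟨hAh, ?_⟩
    have hBG : B = b⁻¹ • (a • A - G) := by
      rw [hG, sub_sub_cancel, smul_smul, inv_mul_cancel₀ hb, one_smul]
    rw [hBG, Matrix.mul_smul, Matrix.smul_mul, mul_sub, sub_mul, Matrix.mul_smul, Matrix.smul_mul,
      hAh, hGh]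

end Stabilizer

/-- let `n = 2g+2`, and let `(A,B)` be a pair of real symmetric `n × n`
matrices whose invariant binary form `f` is squarefree over `ℂ`; let `2m` be the number of
zeros of `f` in `P¹(ℝ)`, i.e. the number of distinct real roots of `f(T,1)` plus `1` if the
coefficient of `xⁿ` vanishes. Then the stabilizer of `(A,B)` in `SL_n(ℝ)` is finite, of
cardinality `2^{g+m}` if `m ≥ 1` and `2^{g+1}` if `m = 0`. -/
theorem stabilizer_cardinality
    (g : ℕ) (hg : 1 ≤ g) (n : ℕ) (hn : n = 2 * g + 2)
    (A B : Matrix (Fin n) (Fin n) ℝ) (hA : A.IsSymm) (hB : B.IsSymm)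
    (hsf : Squarefree (invBinForm n (A.map ((↑) : ℝ → ℂ)) (B.map ((↑) : ℝ → ℂ))))
    (m : ℕ)
    (hm : 2 * m =
      ((MvPolynomial.aeval ![Polynomial.X, 1] (invBinForm n A B) :
          Polynomial ℝ).roots.toFinset.card)
        + (if MvPolynomial.coeff (Finsupp.single 0 n) (invBinForm n A B) = 0 then 1 else 0)) :
    {h : Matrix (Fin n) (Fin n) ℝ | h.det = 1 ∧ hᵀ * A * h = A ∧ hᵀ * B * h = B}.Finite ∧
    Nat.card {h : Matrix (Fin n) (Fin n) ℝ | h.det = 1 ∧ hᵀ * A * h = A ∧ hᵀ * B * h = B}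
      = if 1 ≤ m then 2 ^ (g + m) else 2 ^ (g + 1) := by
  classical
  set c : Matrix (Fin n) (Fin n) ℝ →+* Matrix (Fin n) (Fin n) ℂ :=
    Complex.ofRealHom.mapMatrix with hc
  have hcsmul : ∀ (r : ℝ) X, c (r • X) = (r : ℂ) • c X := fun r X => by ext i j; simp [hc]
  have hcinj : Function.Injective c := fun X Y h => by
    ext i j
    simpa [hc] using congrFun (congrFun h i) j
  have hctr : ∀ X, (c X)ᵀ = c Xᵀ := fun X => rfl
  change Squarefree (invBinForm n (c A) (c B)) at hsf
  have hf0 : invBinForm n A B ≠ 0 := by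
    intro h
    refine hsf.ne_zero ?_
    change invBinForm n (A.map Complex.ofRealHom) (B.map Complex.ofRealHom) = 0
    rw [map_invBinForm, h, map_zero]
  obtain ⟨a, b, hb, hdet⟩ := exists_det_ne_zero hf0
  set G := a • A - b • B with hG
  have hGsymm : Gᵀ = G := by
    rw [hG, transpose_sub, transpose_smul, transpose_smul, hA.eq, hB.eq]
  set M := G⁻¹ * A with hMdef
  have hM : G * M = A := by
    rw [hMdef, ← mul_assoc, mul_nonsing_inv _ (isUnit_iff_ne_zero.mpr hdet), one_mul]
  have hMadj : Mᵀ * G = G * M := by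
    rw [hM]
    nth_rw 1 [← hGsymm]
    rw [← transpose_mul, hM, hA.eq]
  have hcM : ((a : ℂ) • c A - (b : ℂ) • c B) * c M = c A := by
    rw [← hcsmul, ← hcsmul, ← map_sub, ← map_mul, ← hG, hM]
  have hnodup : (c M).charpoly.roots.Nodup :=
    nodup_roots_charpoly_of_squarefree (Complex.ofReal_ne_zero.mpr hb) hcM hsf
  have hcard : (c M).charpoly.roots.toFinset.card = n := by
    rw [Multiset.toFinset_card_of_nodup hnodup,
      ← (IsAlgClosed.splits (c M).charpoly).natDegree_eq_card_roots, charpoly_natDegree_eq_dim,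
      Fintype.card_fin]
  have hmap : (c M).charpoly = M.charpoly.map Complex.ofRealHom :=
    Matrix.charpoly_map M Complex.ofRealHom
  let φ := (Finset.equivFinOfCardEq hcard).symm
  let lam : Fin n → ℂ := fun i => φ i
  have hinj : Function.Injective lam := Subtype.val_injective.comp φ.injective
  have hroot : ∀ i, (c M).charpoly.IsRoot (lam i) := fun i =>
    Polynomial.isRoot_of_mem_roots (Multiset.mem_toFinset.mp (φ i).2)
  have hsurj : ∀ z, (c M).charpoly.IsRoot z → ∃ i, lam i = z := fun z hz =>
    ⟨φ.symm ⟨z, Multiset.mem_toFinset.mpr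
      ((Polynomial.mem_roots (c M).charpoly_monic.ne_zero).mpr hz)⟩, by simp [lam]⟩
  have hconj : ∀ i, ∃ j, lam j = starRingEnd ℂ (lam i) := by
    intro i
    refine hsurj _ ?_
    have h := congrArg (starRingEnd ℂ) (hroot i)
    have hcc : (starRingEnd ℂ).comp Complex.ofRealHom = Complex.ofRealHom := by ext r; simp
    rw [hmap, map_zero, Polynomial.eval_map, Polynomial.hom_eval₂, hcc] at h
    rwa [hmap, Polynomial.IsRoot, Polynomial.eval_map]
  choose σ hσ using hconj
  have hσσ : ∀ i, σ (σ i) = i := fun i => hinj (by rw [hσ, hσ, Complex.conj_conj])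
  have hreal : (Finset.univ.filter fun i => (lam i).im = 0).card = 2 * m := by
    rw [hm, ← card_roots_charpoly hb hdet hM]
    have key : ∀ r : ℝ, r ∈ M.charpoly.roots.toFinset ↔ (c M).charpoly.IsRoot (r : ℂ) := by
      intro r
      rw [Multiset.mem_toFinset, Polynomial.mem_roots M.charpoly_monic.ne_zero, hmap]
      exact (Polynomial.isRoot_map_iff (f := Complex.ofRealHom)
        Complex.ofRealHom.injective).symm
    have hre : ∀ i, (lam i).im = 0 → ((lam i).re : ℂ) = lam i := fun i hi =>
      Complex.ext rfl (by simp [hi])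
    refine Finset.card_bij (fun i _ => (lam i).re) ?_ ?_ ?_
    · intro i hi
      rw [key, hre i (by simpa using hi)]
      exact hroot i
    · intro i hi j hj h
      apply hinj
      rw [← hre i (by simpa using hi), ← hre j (by simpa using hj), h]
    · intro r hr
      obtain ⟨i, hi⟩ := hsurj r ((key r).mp hr)
      exact ⟨i, by simp [hi], by simp [hi]⟩
  have hadj : ∀ h : Matrix (Fin n) (Fin n) ℝ, h * M = M * h → hᵀ * G = G * h := by
    intro h hh
    apply hcinj
    rw [map_mul, map_mul, ← hctr]
    refine transpose_mul_eq_of_commute hinj hroot ?_ ?_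
    · rw [hctr, ← map_mul, ← map_mul, hMadj]
    · rw [← map_mul, ← map_mul, hh]
  rw [stabilizer_eq_involutions hb hdet hM hadj, Nat.card_coe_set_eq]
  obtain ⟨hfin, hncard⟩ := involutions_centralizer M lam hinj hroot σ hσ
  refine ⟨hfin, hncard.trans ?_⟩
  exact ncard_invariant_signs_prod_one σ hσσ (fun i => (lam i).im) (fun i => by simp [hσ])
    (fun i hi => hinj (by rw [hσ, Complex.conj_eq_iff_im.mpr hi])) (by simpa using hn) hreal
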